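/- Let 𝒢 be a class of countable groups and ℰ a class of countable Borel equivalence relations such that: (i) 𝒢 is closed under subgroups and quotients; (ii) every group in 𝒢 has at most countably many subgroups; and (iii) ℰ is closed under Borel reducibility (if E ≤_B F and F ∈ ℰ then E ∈ ℰ) and under countable disjoint unions. If E^X_G ∈ ℰ for every free Borel action of every group G ∈ 𝒢 on a standard Borel space X, then E^X_G ∈ ℰ for every Borel action of every G ∈ 𝒢 on a standard Borel space X. -/

import Mathlib

/-- An action of a group on a set, given by a map `a : G → X → X`. -/
def IsGroupAction {G X : Type*} [Group G] (a : G → X → X) : Prop :=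
  (∀ x, a 1 x = x) ∧ ∀ g h x, a (g * h) x = a g (a h x)

open MulAction
open Subgroup (normalizer)
open scoped Pointwise

/-- In every action, the points of each orbit can be simultaneously moved to a common point. -/
lemma exists_smul_eq_orbit_representative (G α : Type*) [Group G] [MulAction G α] :
    ∃ c : α → G, ∀ (g : G) (x : α), c (g • x) • (g • x) = c x • x := by
  have h (x : α) : ∃ g : G, g • x = (Quotient.mk (orbitRel G α) x).out :=
    (orbitRel_apply (G := G)).1 (Quotient.mk_out (s := orbitRel G α) x)
  choose c hc using h
  refine ⟨c, fun g x => ?_⟩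
  have hq : Quotient.mk (orbitRel G α) (g • x) = Quotient.mk (orbitRel G α) x :=
    Quotient.sound (mem_orbit x g)
  rw [hc, hc, hq]

lemma toConjAct_smul_stabilizer {G α : Type*} [Group G] [MulAction G α] (g : G) (x : α) :
    ConjAct.toConjAct g • stabilizer G x = stabilizer G (g • x) := by
  ext h
  rw [Subgroup.mem_pointwise_smul_iff_inv_smul_mem, ← ConjAct.toConjAct_inv,
    ConjAct.toConjAct_smul, mem_stabilizer_iff, mem_stabilizer_iff, inv_inv, mul_smul, mul_smul,
    inv_smul_eq_iff]

lemma measurableSet_stabilizer_eq {G X : Type*} [Group G] [Countable G] [MulAction G X]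
    [MeasurableSpace X] [StandardBorelSpace X] [MeasurableConstSMul G X] (H : Subgroup G) :
    MeasurableSet {x : X | stabilizer G x = H} := by
  have h : {x : X | stabilizer G x = H} = ⋂ g : G, {x : X | g • x = x ↔ g ∈ H} := by
    ext x
    simp [SetLike.ext_iff]
  rw [h]
  refine MeasurableSet.iInter fun g => ?_
  have hg : MeasurableSet {x : X | g • x = x} :=
    measurableSet_eq_fun (measurable_const_smul g) measurable_id
  by_cases hgH : g ∈ H
  · simpa [hgH] using hg
  · simpa only [hgH, iff_false, Set.compl_ofPred] using hg.compl

section NormalizerQuotient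

variable {G X : Type*} [Group G] [MulAction G X] {H : Subgroup G}

lemma mem_normalizer_of_stabilizer_eq {g : G} {x : X} (hx : stabilizer G x = H)
    (hgx : stabilizer G (g • x) = H) : g ∈ normalizer (H : Set G) := by
  rw [Subgroup.mem_normalizer_iff]
  intro h
  nth_rw 1 [← hx]
  rw [← hgx, mem_stabilizer_iff, mem_stabilizer_iff, mul_smul, mul_smul, inv_smul_smul,
    smul_left_cancel_iff]

lemma stabilizer_smul_eq_of_mem_normalizer {g : G} {x : X} (hx : stabilizer G x = H)
    (hg : g ∈ normalizer (H : Set G)) : stabilizer G (g • x) = H := by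
  ext h
  rw [Subgroup.mem_normalizer_iff''.1 hg h, ← hx, mem_stabilizer_iff, mem_stabilizer_iff,
    mul_smul, mul_smul, inv_smul_eq_iff]

lemma normalizer_smul_eq_iff {x : X} (hx : stabilizer G x = H) (g h : normalizer (H : Set G)) :
    (g : G) • x = (h : G) • x ↔
      (g : normalizer (H : Set G) ⧸ H.subgroupOf (normalizer (H : Set G))) = h := by
  have hmem (k : G) : k ∈ H ↔ k • x = x := by rw [← hx, mem_stabilizer_iff]
  rw [QuotientGroup.eq, Subgroup.mem_subgroupOf, hmem, Subgroup.coe_mul, Subgroup.coe_inv,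
    mul_smul, inv_smul_eq_iff, eq_comm]

/-- The action of `N(H) / H` on the set of points whose stabilizer is `H`. -/
noncomputable def normalizerQuotientSMul (H : Subgroup G)
    (q : normalizer (H : Set G) ⧸ H.subgroupOf (normalizer (H : Set G)))
    (x : {x : X // stabilizer G x = H}) :
    {x : X // stabilizer G x = H} :=
  ⟨(q.out : G) • x.1, stabilizer_smul_eq_of_mem_normalizer x.2 q.out.2⟩

lemma coe_normalizerQuotientSMul (g : normalizer (H : Set G)) (x : {x : X // stabilizer G x = H}) :
    (normalizerQuotientSMul H g x : X) = (g : G) • x.1 :=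
  (normalizer_smul_eq_iff x.2 _ _).2 (QuotientGroup.out_eq' _)

lemma isGroupAction_normalizerQuotientSMul (H : Subgroup G) :
    IsGroupAction (normalizerQuotientSMul (X := X) H) := by
  refine ⟨fun x => Subtype.ext ?_, fun p q x => Subtype.ext ?_⟩
  · rw [← QuotientGroup.mk_one, coe_normalizerQuotientSMul]
    simp
  · induction p using QuotientGroup.induction_on with | H p => ?_
    induction q using QuotientGroup.induction_on with | H q => ?_
    rw [← QuotientGroup.mk_mul, coe_normalizerQuotientSMul, coe_normalizerQuotientSMul,
      coe_normalizerQuotientSMul, Subgroup.coe_mul, mul_smul]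

lemma normalizerQuotientSMul_free
    (q : normalizer (H : Set G) ⧸ H.subgroupOf (normalizer (H : Set G)))
    (x : {x : X // stabilizer G x = H}) (h : normalizerQuotientSMul H q x = x) : q = 1 := by
  induction q using QuotientGroup.induction_on with | H q => ?_
  rw [← QuotientGroup.mk_one, ← normalizer_smul_eq_iff x.2, ← coe_normalizerQuotientSMul, h]
  simp

lemma exists_normalizerQuotientSMul_eq_iff (x y : {x : X // stabilizer G x = H}) :
    (∃ q, normalizerQuotientSMul H q x = y) ↔ ∃ g : G, g • x.1 = y.1 := by
  constructor
  · rintro ⟨q, rfl⟩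
    exact ⟨q.out, rfl⟩
  · rintro ⟨g, hg⟩
    refine ⟨((⟨g, mem_normalizer_of_stabilizer_eq x.2 (hg ▸ y.2)⟩ : normalizer (H : Set G)) :
      normalizer (H : Set G) ⧸ H.subgroupOf (normalizer (H : Set G))), Subtype.ext ?_⟩
    rw [coe_normalizerQuotientSMul, hg]

lemma measurable_normalizerQuotientSMul [MeasurableSpace X] [MeasurableConstSMul G X]
    (q : normalizer (H : Set G) ⧸ H.subgroupOf (normalizer (H : Set G))) :
    Measurable (normalizerQuotientSMul (X := X) H q) :=
  (measurable_subtype_coe.const_smul (q.out : G)).subtype_mk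

end NormalizerQuotient

/-- A map into a countable disjoint union of measurable subsets of `X` is measurable if its two
components are. -/
lemma measurable_sigma_subtype_mk {ι X Z : Type*} [Countable ι] [MeasurableSpace X]
    [MeasurableSpace Z] {s : ι → Set X} (hs : ∀ i, MeasurableSet (s i)) {n : Z → ι} {f : Z → X}
    (hn : ∀ i, MeasurableSet (n ⁻¹' {i})) (hf : Measurable f) (h : ∀ z, f z ∈ s (n z)) :
    Measurable fun z => (⟨n z, f z, h z⟩ : Σ i, s i) := by
  intro t ht
  have hpre : (fun z => (⟨n z, f z, h z⟩ : Σ i, s i)) ⁻¹' t =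
      ⋃ i, n ⁻¹' {i} ∩ f ⁻¹' (Subtype.val '' ((fun u : s i => (⟨i, u⟩ : Σ i, s i)) ⁻¹' t)) := by
    ext z
    simp only [Set.mem_preimage, Set.mem_iUnion, Set.mem_inter_iff, Set.mem_singleton_iff,
      Set.mem_image, Subtype.exists, exists_and_right, exists_eq_right]
    constructor
    · exact fun hz => ⟨n z, rfl, h z, hz⟩
    · rintro ⟨_, rfl, _, hz⟩
      exact hz
  rw [hpre]
  refine MeasurableSet.iUnion fun i => (hn i).inter (hf ?_)
  exact (hs i).subtype_image (MeasurableSpace.measurableSet_iInf.1 ht i)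

/-- **Proposition 7.1 (reducing to free actions via smooth stabilizer selection).**
Let `𝒢` be a class of countable groups and `ℰ` a class of countable Borel equivalence
relations such that: (i) `𝒢` is closed under subgroups and quotients; (ii) any group in `𝒢`
has at most countably many subgroups; (iii) `ℰ` is closed under Borel reducibility and
countable disjoint unions. If `E^X_G ∈ ℰ` for every free Borel action `G ↷ X` with
`G ∈ 𝒢`, then `E^X_G ∈ ℰ` for every Borel action `G ↷ X` with `G ∈ 𝒢`. -/
theorem free_to_general
    (𝒢 : ∀ (G : Type), Group G → Prop)
    (ℰ : ∀ (X : Type), MeasurableSpace X → (X → X → Prop) → Prop)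
    (hsub : ∀ (G : Type) [iG : Group G], 𝒢 G iG →
      ∀ H : Subgroup G, 𝒢 H inferInstance)
    (hquot : ∀ (G : Type) [iG : Group G], 𝒢 G iG →
      ∀ (N : Subgroup G) [N.Normal], 𝒢 (G ⧸ N) inferInstance)
    (hcntsub : ∀ (G : Type) [iG : Group G], 𝒢 G iG → Countable (Subgroup G))
    (hred : ∀ (X Y : Type) [mX : MeasurableSpace X] [mY : MeasurableSpace Y]
      (E : X → X → Prop) (F : Y → Y → Prop) (f : X → Y), Measurable f →
      (∀ x y, E x y ↔ F (f x) (f y)) → ℰ Y mY F → ℰ X mX E)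
    (hunion : ∀ (X : ℕ → Type) [m : ∀ n, MeasurableSpace (X n)]
      (E : ∀ n, X n → X n → Prop), (∀ n, ℰ (X n) (m n) (E n)) →
      ℰ (Σ n, X n) inferInstance
        (fun p q => ∃ (n : ℕ) (x y : X n), p = ⟨n, x⟩ ∧ q = ⟨n, y⟩ ∧ E n x y))
    (hfreecase : ∀ (G : Type) [iG : Group G], 𝒢 G iG → Countable G →
      ∀ (X : Type) [mX : MeasurableSpace X], StandardBorelSpace X →
      ∀ a : G → X → X, IsGroupAction a → (∀ g, Measurable (a g)) →
      (∀ g x, a g x = x → g = 1) →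
      ℰ X mX fun x y => ∃ g, a g x = y) :
    ∀ (G : Type) [iG : Group G], 𝒢 G iG → Countable G →
      ∀ (X : Type) [mX : MeasurableSpace X], StandardBorelSpace X →
      ∀ a : G → X → X, IsGroupAction a → (∀ g, Measurable (a g)) →
      ℰ X mX fun x y => ∃ g, a g x = y := by
  intro G _ hG _ X _ _ a ha hmeas
  let : MulAction G X :=
    { smul := a
      one_smul := ha.1
      mul_smul := ha.2 }
  have : MeasurableConstSMul G X := ⟨hmeas⟩
  have : Countable (Subgroup G) := hcntsub G hG
  change ℰ X _ fun x y => ∃ g : G, g • x = y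
  obtain ⟨e, he⟩ := exists_surjective_nat (Subgroup G)
  obtain ⟨c, hc⟩ := exists_smul_eq_orbit_representative (ConjAct G) (Subgroup G)
  let d (x : X) : G := ConjAct.ofConjAct (c (stabilizer G x))
  have hd (x : X) : stabilizer G (d x • x) = c (stabilizer G x) • stabilizer G x :=
    (toConjAct_smul_stabilizer _ x).symm
  let rep (K : Subgroup G) : ℕ := Function.surjInv he (c K • K)
  have hrep (x : X) : stabilizer G (d x • x) = e (rep (stabilizer G x)) :=
    (hd x).trans (Function.surjInv_eq he _).symm
  have hrep_smul (g : G) (x : X) : rep (stabilizer G (g • x)) = rep (stabilizer G x) := by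
    simp only [rep, ← toConjAct_smul_stabilizer, hc]
  let : MeasurableSpace (Subgroup G) := ⊤
  have hstab : Measurable fun x : X => stabilizer G x :=
    measurable_to_countable' fun H => measurableSet_stabilizer_eq H
  have hdmeas : Measurable fun x : X => d x • x := by
    intro t ht
    have hpre : (fun x : X => d x • x) ⁻¹' t =
        ⋃ K : Subgroup G, {x | stabilizer G x = K} ∩
          (fun x => ConjAct.ofConjAct (c K) • x) ⁻¹' t := by
      ext x
      simp [d]
    rw [hpre]
    exact MeasurableSet.iUnion fun K =>
      (measurableSet_stabilizer_eq K).inter (measurable_const_smul _ ht)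
  refine hred X (Σ n, {x : X // stabilizer G x = e n}) _ _
    (fun x => ⟨rep (stabilizer G x), d x • x, hrep x⟩) ?_ ?_
    (hunion (fun n => {x : X // stabilizer G x = e n})
      (fun n x y => ∃ q, normalizerQuotientSMul (e n) q x = y) fun n => ?_)
  · exact measurable_sigma_subtype_mk (s := fun n => {x : X | stabilizer G x = e n})
      (fun n => measurableSet_stabilizer_eq (e n))
      (fun n => hstab (MeasurableSpace.measurableSet_top (s := rep ⁻¹' {n}))) hdmeas hrep
  · intro x y
    simp only [exists_normalizerQuotientSMul_eq_iff]
    constructor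
    · rintro ⟨g, rfl⟩
      refine ⟨rep (stabilizer G x), ⟨d x • x, hrep x⟩,
        ⟨d (g • x) • g • x, (hrep _).trans (congrArg e (hrep_smul g x))⟩, rfl, ?_,
        d (g • x) * g * (d x)⁻¹, ?_⟩
      · exact Sigma.subtype_ext (hrep_smul g x) rfl
      · simp [mul_smul]
    · rintro ⟨n, u, v, hu, hv, g, hg⟩
      have hu' : d x • x = u.1 := congrArg (fun p => p.2.1) hu
      have hv' : d y • y = v.1 := congrArg (fun p => p.2.1) hv
      refine ⟨(d y)⁻¹ * g * d x, ?_⟩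
      rw [mul_smul, mul_smul, hu', hg, ← hv', inv_smul_smul]
  · exact hfreecase _ (hquot _ (hsub G hG (normalizer (e n : Set G)))
        ((e n).subgroupOf (normalizer (e n : Set G))))
      QuotientGroup.mk_surjective.countable _ (measurableSet_stabilizer_eq (e n)).standardBorel _
      (isGroupAction_normalizerQuotientSMul (e n)) measurable_normalizerQuotientSMul
      normalizerQuotientSMul_free
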